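/- Let (n,m) ∈ ℕ² with n > m and suppose [B_{kδ}, B_{lδ}] = 0 for all pairs (k,l) lexicographically smaller than (n,m), and that the commutation formulas [B_{mδ},B_0] = b_m^{(m)}(B_{mδ+α_0} − B_{(m−1)δ+α_1}) + Σ_{p=1}^{m−1} b_p^{(m)}(B_{pδ+α_0}B_{(m−p)δ} − B_{(m−p)δ}B_{(p−1)δ+α_1}) and [B_1,B_{mδ}] = b_m^{(m)}(B_{mδ+α_1} − B_{(m−1)δ+α_0}) + Σ_{p=1}^{m−1} b_p^{(m)}(B_{(m−p)δ}B_{pδ+α_1} − B_{(p−1)δ+α_0}B_{(m−p)δ}), with b_m^{(m)} = c[2]_q q^{−2(m−1)} and b_p^{(m)} = −(q⁴−1)q^{−2p}, hold for all relevant indices ≤ n. Then [[B_{nδ}, B_{mδ}], B_1] = 0. -/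

import Mathlib

set_option synthInstance.maxHeartbeats 1000000
set_option maxHeartbeats 1000000

noncomputable section

open scoped BigOperators

/-- The field `ℚ(q)` of rational functions. -/
abbrev KK : Type := RatFunc ℚ

/-- The indeterminate `q ∈ ℚ(q)`. -/
def qq : KK := RatFunc.X

/-- The `q`-Dolan–Grady relations defining the `q`-Onsager algebra `B_c`:
`Σᵢ (−1)ⁱ [3 choose i]_q B₀^{3−i} B₁ B₀^i = −qc(q+q⁻¹)²(B₀B₁ − B₁B₀)` and the
same with `B₀, B₁` interchanged (here `[3 choose 1]_q = [3 choose 2]_q = q² + 1 + q⁻²`). -/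
inductive qOnsRel (c : KK) : FreeAlgebra KK (Fin 2) → FreeAlgebra KK (Fin 2) → Prop
  | r0 : qOnsRel c
      (FreeAlgebra.ι KK (0 : Fin 2) ^ 3 * FreeAlgebra.ι KK (1 : Fin 2)
        - (qq ^ 2 + 1 + (qq⁻¹) ^ 2) • (FreeAlgebra.ι KK (0 : Fin 2) ^ 2 * FreeAlgebra.ι KK (1 : Fin 2) * FreeAlgebra.ι KK (0 : Fin 2))
        + (qq ^ 2 + 1 + (qq⁻¹) ^ 2) • (FreeAlgebra.ι KK (0 : Fin 2) * FreeAlgebra.ι KK (1 : Fin 2) * FreeAlgebra.ι KK (0 : Fin 2) ^ 2)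
        - FreeAlgebra.ι KK (1 : Fin 2) * FreeAlgebra.ι KK (0 : Fin 2) ^ 3)
      ((-(qq * c * (qq + qq⁻¹) ^ 2)) •
        (FreeAlgebra.ι KK (0 : Fin 2) * FreeAlgebra.ι KK (1 : Fin 2) - FreeAlgebra.ι KK (1 : Fin 2) * FreeAlgebra.ι KK (0 : Fin 2)))
  | r1 : qOnsRel c
      (FreeAlgebra.ι KK (1 : Fin 2) ^ 3 * FreeAlgebra.ι KK (0 : Fin 2)
        - (qq ^ 2 + 1 + (qq⁻¹) ^ 2) • (FreeAlgebra.ι KK (1 : Fin 2) ^ 2 * FreeAlgebra.ι KK (0 : Fin 2) * FreeAlgebra.ι KK (1 : Fin 2))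
        + (qq ^ 2 + 1 + (qq⁻¹) ^ 2) • (FreeAlgebra.ι KK (1 : Fin 2) * FreeAlgebra.ι KK (0 : Fin 2) * FreeAlgebra.ι KK (1 : Fin 2) ^ 2)
        - FreeAlgebra.ι KK (0 : Fin 2) * FreeAlgebra.ι KK (1 : Fin 2) ^ 3)
      ((-(qq * c * (qq + qq⁻¹) ^ 2)) •
        (FreeAlgebra.ι KK (1 : Fin 2) * FreeAlgebra.ι KK (0 : Fin 2) - FreeAlgebra.ι KK (0 : Fin 2) * FreeAlgebra.ι KK (1 : Fin 2)))

/-- The `q`-Onsager algebra `B_c`. -/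
abbrev QOns (c : KK) : Type := RingQuot (qOnsRel c)

/-- The generator `B₀` of `B_c`. -/
def Bo (c : KK) : QOns c := RingQuot.mkAlgHom KK (qOnsRel c) (FreeAlgebra.ι KK (0 : Fin 2))

/-- The generator `B₁` of `B_c`. -/
def Bi (c : KK) : QOns c := RingQuot.mkAlgHom KK (qOnsRel c) (FreeAlgebra.ι KK (1 : Fin 2))

/-- `B_δ = −B₀B₁ + q⁻²B₁B₀`. -/
def Bdel (c : KK) : QOns c := -(Bo c * Bi c) + ((qq⁻¹) ^ 2) • (Bi c * Bo c)

/-- `B̃_δ = −B₁B₀ + q⁻²B₀B₁`. -/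
def tBdel (c : KK) : QOns c := -(Bi c * Bo c) + ((qq⁻¹) ^ 2) • (Bo c * Bi c)

/-- The formula for `T₀(B₁)`:
`(1/(q²[2]_q c))(B₁B₀² − q[2]_q B₀B₁B₀ + q²B₀²B₁) + B₁`. -/
def T0B1val (c : KK) : QOns c :=
  (qq ^ 2 * (qq + qq⁻¹) * c)⁻¹ •
    (Bi c * Bo c ^ 2 - (qq * (qq + qq⁻¹)) • (Bo c * Bi c * Bo c) + qq ^ 2 • (Bo c ^ 2 * Bi c))
    + Bi c

/-- The formula for `T₀⁻¹(B₁)`: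
`(1/(q²[2]_q c))(B₀²B₁ − q[2]_q B₀B₁B₀ + q²B₁B₀²) + B₁`. -/
def T0invB1val (c : KK) : QOns c :=
  (qq ^ 2 * (qq + qq⁻¹) * c)⁻¹ •
    (Bo c ^ 2 * Bi c - (qq * (qq + qq⁻¹)) • (Bo c * Bi c * Bo c) + qq ^ 2 • (Bi c * Bo c ^ 2))
    + Bi c

/-- `T₁ = Φ ∘ T₀ ∘ Φ`. -/
def T1def (c : KK) (Φ T0 : QOns c ≃ₐ[KK] QOns c) : QOns c ≃ₐ[KK] QOns c :=
  Φ.trans (T0.trans Φ)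

/-- The real root vectors `B_{nδ+α₀} = (T₀Φ)ⁿ(B₀)` for `n ≥ 0`. -/
def Ba0 (c : KK) (Φ T0 : QOns c ≃ₐ[KK] QOns c) (n : ℕ) : QOns c :=
  ((⇑T0 ∘ ⇑Φ)^[n]) (Bo c)

/-- The real root vectors `B_{nδ+α₁} = (T₁⁻¹Φ)ⁿ(B₁)` for `n ≥ 0`. -/
def Ba1 (c : KK) (Φ T0 : QOns c ≃ₐ[KK] QOns c) (n : ℕ) : QOns c :=
  ((⇑(T1def c Φ T0).symm ∘ ⇑Φ)^[n]) (Bi c)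

/-- `B_{kδ+α₁}` for `k ∈ ℤ`, with the convention `B_{kδ+α₁} = B_{(−k−1)δ+α₀}` for `k < 0`. -/
def Ba1Z (c : KK) (Φ T0 : QOns c ≃ₐ[KK] QOns c) (k : ℤ) : QOns c :=
  if 0 ≤ k then Ba1 c Φ T0 k.toNat else Ba0 c Φ T0 (-k - 1).toNat

/-- `B_{kδ+α₀}` for `k ∈ ℤ`, with the convention `B_{kδ+α₀} = B_{(−k−1)δ+α₁}` for `k < 0`. -/
def Ba0Z (c : KK) (Φ T0 : QOns c ≃ₐ[KK] QOns c) (k : ℤ) : QOns c :=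
  if 0 ≤ k then Ba0 c Φ T0 k.toNat else Ba1 c Φ T0 (-k - 1).toNat

/-- `C_m = Σ_{p=0}^{m−2} B_{pδ+α₁} B_{(m−p−2)δ+α₁}` (so `C₀ = C₁ = 0`). -/
def CC (c : KK) (Φ T0 : QOns c ≃ₐ[KK] QOns c) (m : ℕ) : QOns c :=
  ∑ p ∈ Finset.range (m - 1), Ba1 c Φ T0 p * Ba1 c Φ T0 (m - 2 - p)

/-- The imaginary root vectors
`B_{mδ} = −B₀B_{(m−1)δ+α₁} + q⁻²B_{(m−1)δ+α₁}B₀ + (q⁻²−1)C_m` for `m ≥ 1`. -/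
def Bim (c : KK) (Φ T0 : QOns c ≃ₐ[KK] QOns c) (m : ℕ) : QOns c :=
  -(Bo c * Ba1 c Φ T0 (m - 1)) + ((qq⁻¹) ^ 2) • (Ba1 c Φ T0 (m - 1) * Bo c)
    + (((qq⁻¹) ^ 2 - 1)) • CC c Φ T0 m



section Abstract

variable {K R : Type*} [Field K] [Ring R] [Algebra K R]

/-- Right hand side of the commutation formula `[A_k, D_j]`. -/
def XX (A : ℤ → R) (D : ℕ → R) (β b : ℕ → K) (j : ℕ) (k : ℤ) : R :=
  β j • (A (k + j) - A (k - j)) + ∑ p ∈ Finset.Icc 1 (j - 1),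
    b p • (D (j - p) * A (k + p) - A (k - p) * D (j - p))

/-- Mixed terms. -/
def UU (A : ℤ → R) (D : ℕ → R) (β b : ℕ → K) (i j : ℕ) : R :=
  ∑ p ∈ Finset.Icc 1 (j - 1), (b p * β i) •
    (D (j - p) * (A (p + i) - A (p - i)) - (A (-p + i) - A (-p - i)) * D (j - p))

/-- Double sum terms. -/
def WW (A : ℤ → R) (D : ℕ → R) (b : ℕ → K) (i j : ℕ) : R :=
  ∑ p ∈ Finset.Icc 1 (j - 1), ∑ r ∈ Finset.Icc 1 (i - 1), (b p * b r) •
    (D (j - p) * (D (i - r) * A (p + r)) - D (j - p) * (A (p - r) * D (i - r))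
      - D (i - r) * (A (r - p) * D (j - p)) + A (-p - r) * (D (i - r) * D (j - p)))

theorem comm_XX (A : ℤ → R) (D : ℕ → R) (β b : ℕ → K) (i j : ℕ)
    (hX : ∀ k : ℤ, A k * D i - D i * A k = XX A D β b i k)
    (hD : ∀ p ∈ Finset.Icc 1 (j - 1), D i * D (j - p) = D (j - p) * D i) :
    XX A D β b j 0 * D i - D i * XX A D β b j 0
      = β j • (XX A D β b i j - XX A D β b i (-j)) + ∑ p ∈ Finset.Icc 1 (j - 1),
        b p • (D (j - p) * XX A D β b i p - XX A D β b i (-p) * D (j - p)) := by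
  simp only [← hX]
  rw [XX, add_mul, mul_add, Finset.sum_mul, Finset.mul_sum, add_sub_add_comm,
    ← Finset.sum_sub_distrib]
  congr 1
  · simp only [zero_add, zero_sub, smul_mul_assoc, mul_smul_comm, mul_sub, sub_mul]
    module
  · refine Finset.sum_congr rfl fun p hp => ?_
    have h := hD p hp
    have h1 : D i * (D (j - p) * A p) = D (j - p) * (D i * A p) := by
      rw [← mul_assoc, h, mul_assoc]
    simp only [zero_add, zero_sub, smul_mul_assoc, mul_smul_comm, mul_sub, sub_mul, mul_assoc, h1, h]
    module

theorem comm_expand (A : ℤ → R) (D : ℕ → R) (β b : ℕ → K) (i j : ℕ) :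
    β j • (XX A D β b i j - XX A D β b i (-j)) + ∑ p ∈ Finset.Icc 1 (j - 1),
        b p • (D (j - p) * XX A D β b i p - XX A D β b i (-p) * D (j - p))
    = (β j * β i) • (A (j + i) - A (j - i) - A (-j + i) + A (-j - i))
      + UU A D β b j i + UU A D β b i j + WW A D b i j := by
  have h1 : β j • (XX A D β b i j - XX A D β b i (-j))
      = (β j * β i) • (A (j + i) - A (j - i) - A (-j + i) + A (-j - i)) + UU A D β b j i := by
    unfold XX UU
    rw [add_sub_add_comm, ← Finset.sum_sub_distrib, smul_add, Finset.smul_sum]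
    congr 1
    · module
    · refine Finset.sum_congr rfl fun p hp => ?_
      have e1 : (p : ℤ) + j = j + p := by ring
      have e2 : (p : ℤ) - j = -j + p := by ring
      have e3 : -(p : ℤ) + j = j - p := by ring
      have e4 : -(p : ℤ) - j = -j - p := by ring
      rw [e1, e2, e3, e4]
      simp only [mul_sub, sub_mul]
      module
  have h2 : ∑ p ∈ Finset.Icc 1 (j - 1),
        b p • (D (j - p) * XX A D β b i p - XX A D β b i (-p) * D (j - p))
      = UU A D β b i j + WW A D b i j := by
    unfold UU WW
    rw [← Finset.sum_add_distrib]
    refine Finset.sum_congr rfl fun p hp => ?_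
    unfold XX
    rw [add_mul, mul_add, Finset.sum_mul, Finset.mul_sum, add_sub_add_comm,
      ← Finset.sum_sub_distrib, smul_add, Finset.smul_sum]
    congr 1
    · simp only [smul_mul_assoc, mul_smul_comm, mul_sub, sub_mul]
      module
    · refine Finset.sum_congr rfl fun r hr => ?_
      have e3 : -(p : ℤ) + r = r - p := by ring
      rw [e3]
      simp only [smul_mul_assoc, mul_smul_comm, mul_sub, sub_mul, mul_assoc]
      module
  rw [h1, h2]
  abel

theorem WW_symm (A : ℤ → R) (D : ℕ → R) (b : ℕ → K) (i j : ℕ)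
    (hD : ∀ p ∈ Finset.Icc 1 (j - 1), ∀ r ∈ Finset.Icc 1 (i - 1),
      D (i - r) * D (j - p) = D (j - p) * D (i - r)) :
    WW A D b i j = WW A D b j i := by
  unfold WW
  rw [Finset.sum_comm]
  refine Finset.sum_congr rfl fun r hr => Finset.sum_congr rfl fun p hp => ?_
  have h := hD p hp r hr
  have h1 : D (i - r) * (D (j - p) * A (r + p)) = D (j - p) * (D (i - r) * A (r + p)) := by
    rw [← mul_assoc, h, mul_assoc]
  have e1 : (p : ℤ) + r = r + p := by ring
  have e2 : -(p : ℤ) - r = -r - p := by ring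
  rw [e1, e2, h1, h]
  module

theorem main_abstract (A : ℤ → R) (D : ℕ → R) (β b : ℕ → K) (n m : ℕ) (hm : 1 ≤ m) (hnm : m < n)
    (hX : ∀ j, 1 ≤ j → j ≤ n → ∀ k : ℤ, A k * D j - D j * A k = XX A D β b j k)
    (hprev : ∀ k l : ℕ, 1 ≤ l → l < k → (k < n ∨ (k = n ∧ l < m)) → D k * D l - D l * D k = 0) :
    (D n * D m - D m * D n) * A 0 - A 0 * (D n * D m - D m * D n) = 0 := by
  have hlt : ∀ k l, 1 ≤ k → k < n → 1 ≤ l → l < n → D k * D l = D l * D k := by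
    intro k l hk hkn hl hln
    rcases lt_trichotomy k l with h | h | h
    · exact (sub_eq_zero.mp (hprev l k hk h (Or.inl hln))).symm
    · rw [h]
    · exact sub_eq_zero.mp (hprev k l hl h (Or.inl hkn))
  have hn := hX n (by omega) le_rfl
  have hm' := hX m hm hnm.le
  have c1 := comm_XX A D β b n m hn (by
    intro p hp
    rw [Finset.mem_Icc] at hp
    exact sub_eq_zero.mp (hprev n (m - p) (by omega) (by omega) (Or.inr ⟨rfl, by omega⟩)))
  have c2 := comm_XX A D β b m n hm' (by
    intro p hp
    rw [Finset.mem_Icc] at hp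
    exact hlt _ _ (by omega) (by omega) (by omega) (by omega))
  rw [comm_expand] at c1 c2
  have hW := WW_symm A D b n m (by
    intro p hp r hr
    rw [Finset.mem_Icc] at hp hr
    exact hlt _ _ (by omega) (by omega) (by omega) (by omega))
  have key : (D n * D m - D m * D n) * A 0 - A 0 * (D n * D m - D m * D n)
      = (XX A D β b m 0 * D n - D n * XX A D β b m 0)
        - (XX A D β b n 0 * D m - D m * XX A D β b n 0) := by
    rw [← hn, ← hm']
    noncomm_ring
  rw [key, c1, c2, hW]
  have e1 : (m : ℤ) + n = n + m := by ring
  have e2 : -(m : ℤ) + n = n - m := by ring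
  have e3 : -(n : ℤ) + m = m - n := by ring
  have e4 : -(m : ℤ) - n = -n - m := by ring
  rw [e1, e2, e3, e4]
  module

/-- Shifted imaginary root vectors. -/
def FF (A : ℤ → R) (s : K) (m : ℕ) (r : ℤ) : R :=
  -(A (r - 1) * A (m + r - 1)) + s • (A (m + r - 1) * A (r - 1))
    + (s - 1) • ∑ p ∈ Finset.range (m - 1), A (p + r) * A (m - 2 - p + r)

theorem FF_shift (A : ℤ → R) (s : K) (σ : R ≃ₐ[K] R) (hσ : ∀ k, σ (A k) = A (k + 1))
    (m : ℕ) (r : ℤ) : σ (FF A s m r) = FF A s m (r + 1) := by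
  unfold FF
  simp only [map_add, map_neg, map_mul, map_smul, map_sum, hσ]
  have e1 : r - 1 + 1 = r + 1 - 1 := by ring
  have e2 : (m : ℤ) + r - 1 + 1 = m + (r + 1) - 1 := by ring
  rw [e1, e2]
  simp only [add_assoc]

theorem comm_mul (d x y : R) : d * (x * y) - (x * y) * d
    = (d * x - x * d) * y + x * (d * y - y * d) := by noncomm_ring

theorem D1_FF (A : ℤ → R) (s β : K) (d : R)
    (hd : ∀ k, d * A k - A k * d = β • (A (k - 1) - A (k + 1))) (k : ℕ) :
    d * FF A s (k + 2) 0 - FF A s (k + 2) 0 * d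
      = β • (FF A s (k + 3) (-1) - FF A s (k + 3) 0 + FF A s (k + 1) 0 - FF A s (k + 1) 1) := by
  have step : d * FF A s (k + 2) 0 - FF A s (k + 2) 0 * d
      = -(d * (A (-1) * A (k + 1)) - (A (-1) * A (k + 1)) * d)
       + s • (d * (A (k + 1) * A (-1)) - (A (k + 1) * A (-1)) * d)
       + (s - 1) • ∑ p ∈ Finset.range (k + 1),
          (d * (A p * A (k - p)) - (A p * A (k - p)) * d) := by
    unfold FF
    rw [Finset.sum_sub_distrib, ← Finset.mul_sum, ← Finset.sum_mul]
    have e1 : ((k + 2 : ℕ) : ℤ) + 0 - 1 = k + 1 := by push_cast; ring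
    have e2 : ∀ p : ℕ, ((k + 2 : ℕ) : ℤ) - 2 - p + 0 = k - p := by intro p; push_cast; ring
    have e3 : k + 2 - 1 = k + 1 := by omega
    rw [e1]
    simp only [e2, e3, zero_sub, add_zero]
    simp only [mul_add, add_mul, smul_mul_assoc, mul_smul_comm, mul_neg, neg_mul]
    module
  rw [step]
  simp only [comm_mul d, hd]
  have hs : ∑ p ∈ Finset.range (k + 1), (β • (A ((p : ℤ) - 1) - A (p + 1)) * A (k - p)
        + A p * β • (A ((k : ℤ) - p - 1) - A (k - p + 1)))
      = β • ((∑ p ∈ Finset.range (k + 1), A ((p : ℤ) - 1) * A (k - p))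
        - (∑ p ∈ Finset.range (k + 1), A ((p : ℤ) + 1) * A (k - p))
        + (∑ p ∈ Finset.range (k + 1), A (p : ℤ) * A (k - p - 1))
        - (∑ p ∈ Finset.range (k + 1), A (p : ℤ) * A (k - p + 1))) := by
    rw [← Finset.sum_sub_distrib, ← Finset.sum_add_distrib, ← Finset.sum_sub_distrib,
      Finset.smul_sum]
    refine Finset.sum_congr rfl fun p _ => ?_
    simp only [smul_mul_assoc, mul_smul_comm, mul_sub, sub_mul]
    module
  rw [hs]
  have f1 : FF A s (k + 3) (-1) = -(A (-2) * A (k + 1)) + s • (A (k + 1) * A (-2))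
      + (s - 1) • (∑ p ∈ Finset.range (k + 1), A ((p : ℤ) - 1) * A (k - p) + A k * A (-1)) := by
    unfold FF
    have e3 : k + 3 - 1 = k + 1 + 1 := by omega
    rw [e3, Finset.sum_range_succ]
    congr 1
    · congr <;> (push_cast; ring)
    · congr 2
      · refine Finset.sum_congr rfl fun p _ => ?_
        congr 2 <;> (push_cast; ring)
      · congr 2 <;> (push_cast; ring)
  have f2 : FF A s (k + 3) 0 = -(A (-1) * A (k + 2)) + s • (A (k + 2) * A (-1))
      + (s - 1) • (∑ p ∈ Finset.range (k + 1), A (p : ℤ) * A (k - p + 1) + A (k + 1) * A 0) := by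
    unfold FF
    have e3 : k + 3 - 1 = k + 1 + 1 := by omega
    rw [e3, Finset.sum_range_succ]
    congr 1
    · congr <;> (push_cast; ring)
    · congr 2
      · refine Finset.sum_congr rfl fun p _ => ?_
        congr 2 <;> (push_cast; ring)
      · congr 2 <;> (push_cast; ring)
  have f3 : FF A s (k + 1) 0 = -(A (-1) * A k) + s • (A k * A (-1))
      + (s - 1) • (∑ p ∈ Finset.range (k + 1), A (p : ℤ) * A (k - p - 1) - A k * A (-1)) := by
    unfold FF
    have e3 : k + 1 - 1 = k := by omega
    rw [e3, Finset.sum_range_succ]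
    have e4 : (k : ℤ) - k - 1 = -1 := by ring
    rw [e4, add_sub_cancel_right]
    congr 1
    · congr <;> (push_cast; ring)
    · congr 1
      refine Finset.sum_congr rfl fun p _ => ?_
      congr 2 <;> (push_cast; ring)
  have f4 : FF A s (k + 1) 1 = -(A 0 * A (k + 1)) + s • (A (k + 1) * A 0)
      + (s - 1) • (∑ p ∈ Finset.range (k + 1), A ((p : ℤ) + 1) * A (k - p) - A (k + 1) * A 0) := by
    unfold FF
    have e3 : k + 1 - 1 = k := by omega
    rw [e3, Finset.sum_range_succ]
    have e4 : (k : ℤ) - k = 0 := by ring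
    rw [e4, add_sub_cancel_right _ (A ((k : ℤ) + 1) * A 0)]
    congr 1
    · congr <;> (push_cast; ring)
    · congr 1
      refine Finset.sum_congr rfl fun p _ => ?_
      congr 2 <;> (push_cast; ring)
  rw [f1, f2, f3, f4]
  have e1 : (k : ℤ) + 1 - 1 = k := by ring
  have e2 : (k : ℤ) + 1 + 1 = k + 2 := by ring
  have e3 : (-1 : ℤ) - 1 = -2 := by ring
  have e4 : (-1 : ℤ) + 1 = 0 := by ring
  rw [e1, e2, e3, e4]
  simp only [smul_mul_assoc, mul_smul_comm, mul_sub, sub_mul]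
  module

theorem FF_one (A : ℤ → R) (s : K) (r : ℤ) :
    FF A s 1 r = -(A (r - 1) * A r) + s • (A r * A (r - 1)) := by
  unfold FF
  have e1 : ((1 : ℕ) : ℤ) + r - 1 = r := by push_cast; ring
  rw [e1]
  simp

theorem FF_two (A : ℤ → R) (s : K) (β : K) (hβ : β ≠ 0) (d : R) (hd1 : d = FF A s 1 0)
    (hd : ∀ k, d * A k - A k * d = β • (A (k - 1) - A (k + 1))) :
    FF A s 2 (-1) = FF A s 2 0 := by
  have h0 : d * FF A s 1 0 - FF A s 1 0 * d = 0 := by rw [← hd1, sub_self]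
  have step : d * FF A s 1 0 - FF A s 1 0 * d
      = -(d * (A (-1) * A 0) - (A (-1) * A 0) * d)
       + s • (d * (A 0 * A (-1)) - (A 0 * A (-1)) * d) := by
    rw [FF_one, zero_sub]
    simp only [mul_add, add_mul, smul_mul_assoc, mul_smul_comm, mul_neg, neg_mul]
    module
  rw [step] at h0
  simp only [comm_mul d, hd] at h0
  norm_num at h0
  have f1 : FF A s 2 (-1) = -(A (-2) * A 0) + s • (A 0 * A (-2)) + (s - 1) • (A (-1) * A (-1)) := by
    unfold FF; norm_num
  have f2 : FF A s 2 0 = -(A (-1) * A 1) + s • (A 1 * A (-1)) + (s - 1) • (A 0 * A 0) := by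
    unfold FF; norm_num
  rw [← sub_eq_zero]
  have : β • (FF A s 2 (-1) - FF A s 2 0) = 0 := by
    rw [f1, f2, ← h0]
    simp only [smul_mul_assoc, mul_smul_comm, mul_sub, sub_mul]
    module
  exact (smul_eq_zero.mp this).resolve_left hβ

theorem FF_inv (A : ℤ → R) (s : K) (β : K) (hβ : β ≠ 0) (σ : R ≃ₐ[K] R)
    (hσ : ∀ k, σ (A k) = A (k + 1)) (n : ℕ)
    (h1 : σ (FF A s 1 0) = FF A s 1 0)
    (hA0 : A 0 * FF A s 1 0 - FF A s 1 0 * A 0 = β • (A 1 - A (-1)))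
    (hprev : ∀ k, 2 ≤ k → k < n →
      FF A s k 0 * FF A s 1 0 - FF A s 1 0 * FF A s k 0 = 0) :
    ∀ j, 1 ≤ j → j ≤ n → σ (FF A s j 0) = FF A s j 0 := by
  have hup : ∀ k : ℤ, FF A s 1 0 * A k - A k * FF A s 1 0 = β • (A (k - 1) - A (k + 1)) := by
    intro k
    induction k using Int.induction_on with
    | zero =>
      rw [← neg_sub, hA0]
      norm_num
      rw [← smul_neg, neg_sub]
    | succ i ih =>
      have := congrArg σ ih
      simp only [map_sub, map_mul, map_smul, hσ, h1] at this
      rw [this]; congr 3; ring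
    | pred i ih =>
      apply σ.injective
      simp only [map_sub, map_mul, map_smul, hσ, h1]
      have e : -(i : ℤ) - 1 + 1 = -i := by ring
      rw [e, ih]; congr 3; ring
  intro j
  induction j using Nat.strong_induction_on with
  | _ j ih =>
    intro hj hjn
    match j, hj, hjn, ih with
    | 1, _, _, _ => exact h1
    | 2, _, _, _ =>
      have := FF_two A s β hβ _ rfl hup
      rw [← this, FF_shift A s σ hσ, neg_add_cancel, this]
    | k + 3, _, hjn, ih =>
      have hD := D1_FF A s β _ hup k
      have hc := hprev (k + 2) (by omega) (by omega)
      rw [← neg_sub, hc, neg_zero] at hD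
      have h2 := (smul_eq_zero.mp hD.symm).resolve_left hβ
      have h3 := ih (k + 1) (by omega) (by omega) (by omega)
      rw [FF_shift A s σ hσ, zero_add] at h3
      rw [h3, add_sub_assoc, sub_self, add_zero] at h2
      have h4 := sub_eq_zero.mp h2
      rw [← h4, FF_shift A s σ hσ, neg_add_cancel, h4]

theorem D1_inv (x y z d : R) (s t β γ : K) (hβ : β ≠ 0) (hs : s * t = 1)
    (hd : d = -(y * x) + s • (x * y))
    (hz : x * d - d * x = β • (z - y)) (hγ : s * γ = β * (1 + s))
    (hr : x ^ 3 * y - (t + 1 + s) • (x ^ 2 * y * x) + (t + 1 + s) • (x * y * x ^ 2) - y * x ^ 3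
      = (-γ) • (x * y - y * x)) :
    -(x * z) + s • (z * x) = d := by
  rw [← sub_eq_zero]
  have hz2 : β • z = x * d - d * x + β • y := by rw [hz]; module
  have h : β • (-(x * z) + s • (z * x) - d) = 0 := by
    have e : β • (-(x * z) + s • (z * x) - d) = -(x * (β • z)) + s • ((β • z) * x) - β • d := by
      simp only [smul_mul_assoc, mul_smul_comm]; module
    have hr' := congrArg (fun u => (-s) • u) hr
    simp only [smul_smul, neg_mul_neg] at hr'
    rw [hγ] at hr'
    have e2 : (-s) • (x ^ 3 * y - (t + 1 + s) • (x ^ 2 * y * x) + (t + 1 + s) • (x * y * x ^ 2)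
        - y * x ^ 3) = (-s) • (x ^ 3 * y) + (1 + s + s * s) • (x ^ 2 * y * x)
        - (1 + s + s * s) • (x * y * x ^ 2) + s • (y * x ^ 3) := by
      have e3 : 1 + s + s * s = s * (t + 1 + s) := by linear_combination -hs
      rw [e3]; module
    rw [e2] at hr'
    rw [← sub_eq_zero] at hr'
    rw [e, hz2, hd, ← hr']
    simp only [smul_mul_assoc, mul_smul_comm, mul_sub, sub_mul, mul_add, add_mul, mul_neg, neg_mul,
      smul_add, smul_sub, smul_neg, pow_succ, pow_zero, one_mul, mul_assoc]
    module
  exact (smul_eq_zero.mp h).resolve_left hβ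

end Abstract

section Concrete

variable (c : KK) (Φ T0 : QOns c ≃ₐ[KK] QOns c)

/-- The shift automorphism, inverse of `T₀Φ`. -/
def sig : QOns c ≃ₐ[KK] QOns c := T0.symm.trans Φ.symm

theorem Ba1_succ (k : ℕ) : Ba1 c Φ T0 (k + 1) = sig c Φ T0 (Ba1 c Φ T0 k) := by
  unfold Ba1
  rw [Function.iterate_succ_apply']
  simp [T1def, sig]

theorem sig_Ba0_succ (k : ℕ) : sig c Φ T0 (Ba0 c Φ T0 (k + 1)) = Ba0 c Φ T0 k := by
  unfold Ba0
  rw [Function.iterate_succ_apply']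
  simp [sig]

theorem Ba1Z_nat (k : ℕ) : Ba1Z c Φ T0 k = Ba1 c Φ T0 k := by simp [Ba1Z]

theorem Ba1Z_neg (k : ℕ) : Ba1Z c Φ T0 (-(k : ℤ) - 1) = Ba0 c Φ T0 k := by
  unfold Ba1Z
  rw [if_neg (by omega)]
  congr 1
  omega

theorem sig_Ba1Z (hΦ1 : Φ (Bi c) = Bo c) (hT00 : T0 (Bo c) = Bo c) (k : ℤ) :
    sig c Φ T0 (Ba1Z c Φ T0 k) = Ba1Z c Φ T0 (k + 1) := by
  rcases lt_or_ge k 0 with h | h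
  · obtain ⟨j, rfl⟩ : ∃ j : ℕ, k = -(j : ℤ) - 1 := ⟨(-k - 1).toNat, by omega⟩
    rw [Ba1Z_neg]
    cases j with
    | zero =>
      have e : -((0 : ℕ) : ℤ) - 1 + 1 = ((0 : ℕ) : ℤ) := by norm_num
      rw [e, Ba1Z_nat]
      simp only [Ba0, Ba1, Function.iterate_zero, id_eq, sig, AlgEquiv.trans_apply]
      rw [AlgEquiv.symm_apply_eq, AlgEquiv.symm_apply_eq, hΦ1, hT00]
    | succ i =>
      rw [sig_Ba0_succ, ← Ba1Z_neg]
      congr 1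
      push_cast; ring
  · obtain ⟨j, rfl⟩ := Int.eq_ofNat_of_zero_le h
    rw [Ba1Z_nat, ← Ba1_succ, ← Ba1Z_nat]
    push_cast; rfl

theorem Ba1Z_neg_one : Ba1Z c Φ T0 (-1) = Bo c := by
  have := Ba1Z_neg c Φ T0 0
  simpa [Ba0] using this

theorem Ba1Z_zero : Ba1Z c Φ T0 0 = Bi c := by
  have := Ba1Z_nat c Φ T0 0
  simpa [Ba1] using this

theorem Bim_eq (m : ℕ) (hm : 1 ≤ m) :
    Bim c Φ T0 m = FF (Ba1Z c Φ T0) ((qq⁻¹) ^ 2) m 0 := by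
  unfold Bim FF CC
  have e1 : (m : ℤ) + 0 - 1 = ((m - 1 : ℕ) : ℤ) := by omega
  rw [e1, Ba1Z_nat, zero_sub, Ba1Z_neg_one]
  congr 2
  refine Finset.sum_congr rfl fun p hp => ?_
  rw [Finset.mem_range] at hp
  have e2 : (m : ℤ) - 2 - p + 0 = ((m - 2 - p : ℕ) : ℤ) := by omega
  rw [e2, Ba1Z_nat, add_zero, Ba1Z_nat]

theorem rel1 : Bi c ^ 3 * Bo c - (qq ^ 2 + 1 + (qq⁻¹) ^ 2) • (Bi c ^ 2 * Bo c * Bi c)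
        + (qq ^ 2 + 1 + (qq⁻¹) ^ 2) • (Bi c * Bo c * Bi c ^ 2) - Bo c * Bi c ^ 3
      = (-(qq * c * (qq + qq⁻¹) ^ 2)) • (Bi c * Bo c - Bo c * Bi c) := by
  have := RingQuot.mkAlgHom_rel KK (qOnsRel.r1 (c := c))
  simp only [map_sub, map_add, map_smul, map_mul, map_pow] at this
  exact this

theorem qq_ne : qq ≠ 0 := RatFunc.X_ne_zero

theorem qq_sum_ne : qq + qq⁻¹ ≠ 0 := by
  intro h
  have h2 : qq ^ 2 + 1 = 0 := by
    have := congrArg (fun u => qq * u) h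
    simp only [mul_add, mul_inv_cancel₀ qq_ne, mul_zero] at this
    rw [← this]; ring
  have h3 : algebraMap (Polynomial ℚ) KK (Polynomial.X ^ 2 + 1) = 0 := by
    rw [← h2]; simp [qq]
  rw [map_eq_zero_iff _ (RatFunc.algebraMap_injective ℚ)] at h3
  have := congrArg (Polynomial.eval 0) h3
  simp at this

end Concrete

/-- If the imaginary root vectors commute for lexicographically smaller pairs and the
commutation formulas of Lemma 5.6 hold for indices `≤ n`, then `[[B_{nδ},B_{mδ}],B₁] = 0`. -/
theorem stmt17 (c : KK) (hc : c ≠ 0) (Φ T0 : QOns c ≃ₐ[KK] QOns c)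
    (hΦ0 : Φ (Bo c) = Bi c) (hΦ1 : Φ (Bi c) = Bo c)
    (hT00 : T0 (Bo c) = Bo c) (hT01 : T0 (Bi c) = T0B1val c)
    (n m : ℕ) (hm : 1 ≤ m) (hnm : m < n)
    (hprev : ∀ k l : ℕ, 1 ≤ l → l < k → (k < n ∨ (k = n ∧ l < m)) →
      Bim c Φ T0 (k) * Bim c Φ T0 (l) - Bim c Φ T0 (l) * Bim c Φ T0 (k) = 0)
    (hB0 : ∀ m' : ℕ, 1 ≤ m' → m' ≤ n → Bim c Φ T0 (m') * Bo c - Bo c * Bim c Φ T0 (m') = (c * (qq + qq⁻¹) * (qq⁻¹) ^ (2 * (m' - 1))) • (Ba0 c Φ T0 (m') - Ba1 c Φ T0 (m' - 1)) + ∑ p ∈ Finset.Icc 1 (m' - 1), (-(qq ^ 4 - 1) * (qq⁻¹) ^ (2 * p)) • (Ba0 c Φ T0 (p) * Bim c Φ T0 (m' - p) - Bim c Φ T0 (m' - p) * Ba1 c Φ T0 (p - 1)))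
    (hB1 : ∀ m' : ℕ, 1 ≤ m' → m' ≤ n → Bi c * Bim c Φ T0 (m') - Bim c Φ T0 (m') * Bi c = (c * (qq + qq⁻¹) * (qq⁻¹) ^ (2 * (m' - 1))) • (Ba1 c Φ T0 (m') - Ba0 c Φ T0 (m' - 1)) + ∑ p ∈ Finset.Icc 1 (m' - 1), (-(qq ^ 4 - 1) * (qq⁻¹) ^ (2 * p)) • (Bim c Φ T0 (m' - p) * Ba1 c Φ T0 (p) - Ba0 c Φ T0 (p - 1) * Bim c Φ T0 (m' - p))) :
    (Bim c Φ T0 (n) * Bim c Φ T0 (m) - Bim c Φ T0 (m) * Bim c Φ T0 (n)) * Bi c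
      - Bi c * (Bim c Φ T0 (n) * Bim c Φ T0 (m) - Bim c Φ T0 (m) * Bim c Φ T0 (n)) = 0 := by
  have hβ : c * (qq + qq⁻¹) ≠ 0 := mul_ne_zero hc qq_sum_ne
  have hq := qq_ne
  have hσ := sig_Ba1Z c Φ T0 hΦ1 hT00
  have hn1 : 1 ≤ n := by omega
  have hd := Bim_eq c Φ T0 1 le_rfl
  -- commutation formula at `A₀`
  have hX0 : ∀ j, 1 ≤ j → j ≤ n → Ba1Z c Φ T0 0 * Bim c Φ T0 j - Bim c Φ T0 j * Ba1Z c Φ T0 0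
      = XX (Ba1Z c Φ T0) (Bim c Φ T0) (fun j => c * (qq + qq⁻¹) * (qq⁻¹) ^ (2 * (j - 1)))
        (fun p => -(qq ^ 4 - 1) * (qq⁻¹) ^ (2 * p)) j 0 := by
    intro j hj hjn
    have neg : ∀ p : ℕ, 1 ≤ p → Ba1Z c Φ T0 (0 - (p : ℤ)) = Ba0 c Φ T0 (p - 1) := by
      intro p hp
      rw [← Ba1Z_neg]
      congr 1
      omega
    rw [Ba1Z_zero, hB1 j hj hjn, XX]
    simp only [zero_add, Ba1Z_nat]
    rw [neg j hj]
    congr 1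
    refine Finset.sum_congr rfl fun p hp => ?_
    rw [neg p (Finset.mem_Icc.mp hp).1]
  have hA0 : Ba1Z c Φ T0 0 * Bim c Φ T0 1 - Bim c Φ T0 1 * Ba1Z c Φ T0 0
      = (c * (qq + qq⁻¹)) • (Ba1Z c Φ T0 1 - Ba1Z c Φ T0 (-1)) := by
    rw [hX0 1 le_rfl hn1]
    simp [XX]
  have h1 : sig c Φ T0 (Bim c Φ T0 1) = Bim c Φ T0 1 := by
    rw [hd, FF_shift _ _ _ hσ, ← hd, FF_one]
    norm_num only [zero_add, sub_self]
    refine D1_inv (Ba1Z c Φ T0 0) (Ba1Z c Φ T0 (-1)) (Ba1Z c Φ T0 1) (Bim c Φ T0 1)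
      _ (qq ^ 2) (c * (qq + qq⁻¹)) (qq * c * (qq + qq⁻¹) ^ 2) hβ ?_ ?_ hA0 ?_ ?_
    · field_simp
    · rw [hd, FF_one, zero_sub]
    · field_simp
    · rw [Ba1Z_zero, Ba1Z_neg_one]
      have := rel1 c
      norm_num at this ⊢
      exact this
  have hinv : ∀ j, 1 ≤ j → j ≤ n → sig c Φ T0 (Bim c Φ T0 j) = Bim c Φ T0 j := by
    intro j hj hjn
    rw [Bim_eq c Φ T0 j hj]
    refine FF_inv _ _ (c * (qq + qq⁻¹)) hβ _ hσ n ?_ ?_ ?_ j hj hjn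
    · rw [← hd, h1]
    · rw [← hd, hA0]
    · intro k hk hkn
      rw [← hd, ← Bim_eq c Φ T0 k (by omega)]
      exact hprev k 1 le_rfl (by omega) (Or.inl hkn)
  have hXshift : ∀ j, 1 ≤ j → j ≤ n → ∀ k : ℤ, sig c Φ T0
      (XX (Ba1Z c Φ T0) (Bim c Φ T0) (fun j => c * (qq + qq⁻¹) * (qq⁻¹) ^ (2 * (j - 1)))
        (fun p => -(qq ^ 4 - 1) * (qq⁻¹) ^ (2 * p)) j k)
      = XX (Ba1Z c Φ T0) (Bim c Φ T0) (fun j => c * (qq + qq⁻¹) * (qq⁻¹) ^ (2 * (j - 1)))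
        (fun p => -(qq ^ 4 - 1) * (qq⁻¹) ^ (2 * p)) j (k + 1) := by
    intro j hj hjn k
    unfold XX
    simp only [map_add, map_sum, map_smul, map_sub, map_mul, hσ]
    have e1 : ∀ p : ℤ, k + p + 1 = k + 1 + p := by intro p; ring
    have e2 : ∀ p : ℤ, k - p + 1 = k + 1 - p := by intro p; ring
    simp only [e1, e2]
    congr 1
    refine Finset.sum_congr rfl fun p hp => ?_
    rw [Finset.mem_Icc] at hp
    rw [hinv (j - p) (by omega) (by omega)]
  have hX : ∀ j, 1 ≤ j → j ≤ n → ∀ k : ℤ,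
      Ba1Z c Φ T0 k * Bim c Φ T0 j - Bim c Φ T0 j * Ba1Z c Φ T0 k
      = XX (Ba1Z c Φ T0) (Bim c Φ T0) (fun j => c * (qq + qq⁻¹) * (qq⁻¹) ^ (2 * (j - 1)))
        (fun p => -(qq ^ 4 - 1) * (qq⁻¹) ^ (2 * p)) j k := by
    intro j hj hjn k
    induction k using Int.induction_on with
    | zero => exact hX0 j hj hjn
    | succ i ih =>
      have := congrArg (sig c Φ T0) ih
      rw [hXshift j hj hjn] at this
      simpa only [map_sub, map_mul, hσ, hinv j hj hjn] using this
    | pred i ih =>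
      apply (sig c Φ T0).injective
      rw [hXshift j hj hjn]
      simp only [map_sub, map_mul, hσ, hinv j hj hjn]
      have e : -(i : ℤ) - 1 + 1 = -i := by ring
      rw [e, ih]
  have := main_abstract (Ba1Z c Φ T0) (Bim c Φ T0) _ _ n m hm hnm hX hprev
  rwa [Ba1Z_zero] at this

end
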